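/- Let V be a type and Eb, Er binary relations on V such that the asymmetric part of the transitive closure of Eb admits no infinite walk. Let 𝒞 ⊆ 𝒮 be a nonempty collection that is a chain for the order ≤ (i.e., any two members S, U ∈ 𝒞 satisfy S ≤ U or U ≤ S, where ≤ is ≤_{Asym(Eb⁺)}). Then the set S^∞_𝒞 is nonempty, and every S ∈ 𝒞 satisfies S ≤ S^∞_𝒞. -/

import Mathlib

/-- The asymmetric part of a binary relation. -/
def Asym {V : Type*} (R : V → V → Prop) : V → V → Prop :=
  fun x y => R x y ∧ ¬ R y x

/-- `f` is an infinite (outward) walk for `R`. -/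
def InfWalk {V : Type*} (R : V → V → Prop) (f : ℕ → V) : Prop :=
  ∀ n : ℕ, R (f n) (f (n + 1))

/-- The monochromatic relation: union of the two transitive closures. -/
def Mono {V : Type*} (Eb Er : V → V → Prop) : V → V → Prop :=
  fun x y => Relation.TransGen Eb x y ∨ Relation.TransGen Er x y

/-- `S` is `R`-independent. -/
def Indep {V : Type*} (R : V → V → Prop) (S : Set V) : Prop :=
  ∀ x ∈ S, ∀ y ∈ S, x = y ∨ ¬ R x y

/-- The order `≤_R` on subsets induced by a relation `R`. -/
def leR {V : Type*} (R : V → V → Prop) (S T : Set V) : Prop :=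
  ∀ s ∈ S, ∃ t ∈ T, s = t ∨ R s t

/-- The collection `𝒮` of nonempty `M`-independent sets `S` such that every
vertex reachable from `S` by a red path reaches `S` by a monochromatic path. -/
def Scal {V : Type*} (Eb Er : V → V → Prop) : Set (Set V) :=
  {S | S.Nonempty ∧ Indep (Mono Eb Er) S ∧
    ∀ y : V, (∃ s ∈ S, Relation.TransGen Er s y) → ∃ s' ∈ S, Mono Eb Er y s'}

/-- The set `S^∞_𝒞` associated to a collection `𝒞` of subsets. -/
def Sinf {V : Type*} (Eb : V → V → Prop) (C : Set (Set V)) : Set V :=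
  {s | ∃ S ∈ C, ∀ U ∈ C, leR (Asym (Relation.TransGen Eb)) S U → s ∈ U}

theorem Asym.trans {V : Type*} {R : V → V → Prop} (hR : ∀ {a b c}, R a b → R b c → R a c)
    {x y z : V} (hxy : Asym R x y) (hyz : Asym R y z) : Asym R x z :=
  ⟨hR hxy.1 hyz.1, fun hzx => hyz.2 (hR hzx hxy.1)⟩

/-- A relation without infinite walks has a maximal element in every nonempty set. -/
theorem exists_maximal_of_not_infWalk {V : Type*} {R : V → V → Prop}
    (h : ¬ ∃ f : ℕ → V, InfWalk R f) {T : Set V} (hT : T.Nonempty) :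
    ∃ t ∈ T, ∀ t' ∈ T, ¬ R t t' := by
  by_contra! hcon
  choose! g hgT hgR using hcon
  obtain ⟨t₀, ht₀⟩ := hT
  have hmem (n : ℕ) : g^[n] t₀ ∈ T := by
    induction n with
    | zero => exact ht₀
    | succ n ih => rw [Function.iterate_succ_apply']; exact hgT _ ih
  refine h ⟨fun n => g^[n] t₀, fun n => ?_⟩
  simp only [Function.iterate_succ_apply']
  exact hgR _ (hmem n)

/-- Every member of a collection lies below `Sinf` of the collection. -/
theorem leR_Sinf {V : Type*} {Eb : V → V → Prop}
    (hb : ¬ ∃ f : ℕ → V, InfWalk (Asym (Relation.TransGen Eb)) f)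
    {C : Set (Set V)} {S : Set V} (hS : S ∈ C) :
    leR (Asym (Relation.TransGen Eb)) S (Sinf Eb C) := by
  intro s hs
  obtain ⟨t, ⟨⟨U, hU, htU⟩, hst⟩, hmax⟩ := exists_maximal_of_not_infWalk hb
    (T := {t | (∃ U ∈ C, t ∈ U) ∧ (s = t ∨ Asym (Relation.TransGen Eb) s t)})
    ⟨s, ⟨S, hS, hs⟩, Or.inl rfl⟩
  refine ⟨t, ⟨U, hU, fun W hW hUW => ?_⟩, hst⟩
  obtain ⟨t', ht', rfl | htt'⟩ := hUW t htU
  · exact ht'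
  · refine absurd htt' (hmax t' ⟨⟨W, hW, ht'⟩, Or.inr ?_⟩)
    rcases hst with rfl | hst
    · exact htt'
    · exact hst.trans Relation.TransGen.trans htt'

theorem stmt6 {V : Type*} (Eb Er : V → V → Prop)
    (hb : ¬ ∃ f : ℕ → V, InfWalk (Asym (Relation.TransGen Eb)) f)
    (C : Set (Set V)) (hC : C ⊆ Scal Eb Er) (hne : C.Nonempty)
    (hchain : ∀ S ∈ C, ∀ U ∈ C,
      leR (Asym (Relation.TransGen Eb)) S U ∨ leR (Asym (Relation.TransGen Eb)) U S) :
    (Sinf Eb C).Nonempty ∧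
      ∀ S ∈ C, leR (Asym (Relation.TransGen Eb)) S (Sinf Eb C) := by
  have hle : ∀ S ∈ C, leR (Asym (Relation.TransGen Eb)) S (Sinf Eb C) :=
    fun S hS => leR_Sinf hb hS
  obtain ⟨S, hS⟩ := hne
  obtain ⟨s, hs⟩ := (hC hS).1
  obtain ⟨t, ht, -⟩ := hle S hS s hs
  exact ⟨⟨t, ht⟩, hle⟩
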